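/- Let V be an oriented 4-dimensional real vector space, W a 3-dimensional real vector space, and (ω,φ) an elliptic pair of 2-forms on V. Then for every injective linear map A : W → V, the pulled-back 2-forms A*ω and A*φ are linearly independent in Λ²W*. -/

import Mathlib

open scoped TensorProduct

/-- The wedge product of an `m`-form and an `n`-form on a real vector space `V`,
defined via `AlternatingMap.domCoprod` (sum over shuffles). -/
noncomputable def wedge {V : Type*} [AddCommGroup V] [Module ℝ V] {m n : ℕ}
    (ω : V [⋀^Fin m]→ₗ[ℝ] ℝ) (φ : V [⋀^Fin n]→ₗ[ℝ] ℝ) :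
    V [⋀^Fin (m + n)]→ₗ[ℝ] ℝ :=
  (TensorProduct.lid ℝ ℝ).toLinearMap.compAlternatingMap
    ((ω.domCoprod φ).domDomCongr finSumFinEquiv)

/-- The wedge product of two `2`-forms as a sum over all permutations. -/
theorem four_mul_wedge_apply {V : Type*} [AddCommGroup V] [Module ℝ V]
    (ω φ : V [⋀^Fin 2]→ₗ[ℝ] ℝ) (v : Fin 4 → V) :
    4 * wedge ω φ v = ∑ σ : Equiv.Perm (Fin 4), (Equiv.Perm.sign σ : ℝ) *
      (ω ![v (σ 0), v (σ 1)] * φ ![v (σ 2), v (σ 3)]) := by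
  have h := congrArg (fun f => TensorProduct.lid ℝ ℝ (f (v ∘ finSumFinEquiv)))
    (MultilinearMap.domCoprod_alternization_eq ω φ)
  have h4 : 4 * wedge ω φ v = TensorProduct.lid ℝ ℝ
      (((Fintype.card (Fin 2)).factorial * (Fintype.card (Fin 2)).factorial) •
        (ω.domCoprod φ) (v ∘ finSumFinEquiv)) := by
    rw [map_nsmul, nsmul_eq_mul]
    congr 1
  rw [h4]
  refine Eq.trans h.symm ?_
  rw [← Equiv.sum_comp (finSumFinEquiv (m := 2) (n := 2)).permCongr]
  simp only [MultilinearMap.alternatization_apply, map_sum]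
  refine Finset.sum_congr rfl fun σ _ => ?_
  rw [Equiv.Perm.sign_permCongr, Units.smul_def, map_zsmul, zsmul_eq_mul]
  congr 1
  simp only [MultilinearMap.domDomCongr_apply, MultilinearMap.domCoprod_apply,
    TensorProduct.lid_tmul, smul_eq_mul, AlternatingMap.coe_multilinearMap]
  congr 2 <;> ext i <;> fin_cases i <;> rfl

/-- The wedge product of two `2`-forms as a sum over shuffles. -/
theorem wedge_apply {V : Type*} [AddCommGroup V] [Module ℝ V]
    (ω φ : V [⋀^Fin 2]→ₗ[ℝ] ℝ) (v : Fin 4 → V) :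
    wedge ω φ v =
      ω ![v 0, v 1] * φ ![v 2, v 3] - ω ![v 0, v 2] * φ ![v 1, v 3]
      + ω ![v 0, v 3] * φ ![v 1, v 2] + ω ![v 1, v 2] * φ ![v 0, v 3]
      - ω ![v 1, v 3] * φ ![v 0, v 2] + ω ![v 2, v 3] * φ ![v 0, v 1] := by
  have hs : ∀ (α : V [⋀^Fin 2]→ₗ[ℝ] ℝ) (i j : Fin 4), α ![v i, v j] = - α ![v j, v i] := by
    intro α i j
    rw [← α.map_swap ![v j, v i] (i := 0) (j := 1) (by decide)]
    congr 1
    ext k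
    fin_cases k <;> simp
  have h := four_mul_wedge_apply ω φ v
  rw [show (3 : Fin 4) = Fin.succ (Fin.succ (Fin.succ 0)) from rfl,
    show (2 : Fin 4) = Fin.succ (Fin.succ 0) from rfl,
    show (1 : Fin 4) = Fin.succ 0 from rfl] at h
  simp only [Finset.univ_perm_fin_succ, Finset.sum_map, ← Finset.univ_product_univ,
    Finset.sum_product, Finset.univ_unique, Finset.sum_singleton,
    Equiv.coe_toEmbedding, Equiv.Perm.decomposeFin.symm_sign,
    Equiv.Perm.decomposeFin_symm_apply_zero, Equiv.Perm.decomposeFin_symm_apply_succ] at h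
  simp [Fin.sum_univ_four, Fin.sum_univ_three, Equiv.swap_apply_def] at h
  rw [hs ω 1 0, hs ω 2 0, hs ω 3 0, hs ω 2 1, hs ω 3 1, hs ω 3 2,
    hs φ 1 0, hs φ 2 0, hs φ 3 0, hs φ 2 1, hs φ 3 1, hs φ 3 2] at h
  linarith

/-- A binary quadratic form with positive discriminant `P * R - Q ^ 2` is anisotropic. -/
theorem eq_zero_of_quadratic_eq_zero {P Q R s t : ℝ} (h : P * R > Q ^ 2)
    (h0 : s ^ 2 * P + 2 * s * t * Q + t ^ 2 * R = 0) : s = 0 ∧ t = 0 := by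
  have ht : t ^ 2 * (P * R - Q ^ 2) + (s * P + t * Q) ^ 2 = 0 := by linear_combination P * h0
  have hs : s ^ 2 * (P * R - Q ^ 2) + (s * Q + t * R) ^ 2 = 0 := by linear_combination R * h0
  constructor
  · by_contra hne
    have := mul_pos (sq_pos_of_ne_zero hne) (sub_pos.2 h)
    linarith [sq_nonneg (s * Q + t * R)]
  · by_contra hne
    have := mul_pos (sq_pos_of_ne_zero hne) (sub_pos.2 h)
    linarith [sq_nonneg (s * P + t * Q)]

/-- the pullback of an elliptic pair of `2`-forms on an oriented
`4`-dimensional real vector space `V` along any injective linear map `A : W → V`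
from a `3`-dimensional real vector space `W` gives two linearly independent
`2`-forms on `W`. -/
theorem stmt4 {V : Type*} [AddCommGroup V] [Module ℝ V]
    [FiniteDimensional ℝ V] (hV : Module.finrank ℝ V = 4)
    {W : Type*} [AddCommGroup W] [Module ℝ W]
    [FiniteDimensional ℝ W] (hW : Module.finrank ℝ W = 3)
    (o : Orientation ℝ V (Fin 4))
    (ε : V [⋀^Fin 4]→ₗ[ℝ] ℝ) (hε : ε ≠ 0)
    (hor : rayOfNeZero ℝ ε hε = o)
    (B : (V [⋀^Fin 2]→ₗ[ℝ] ℝ) → (V [⋀^Fin 2]→ₗ[ℝ] ℝ) → ℝ)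
    (hB : ∀ ω φ : V [⋀^Fin 2]→ₗ[ℝ] ℝ, wedge ω φ = B ω φ • ε)
    (ω φ : V [⋀^Fin 2]→ₗ[ℝ] ℝ)
    (hell : B ω ω * B φ φ > (B ω φ) ^ 2)
    (A : W →ₗ[ℝ] V) (hA : Function.Injective A) :
    LinearIndependent ℝ ![ω.compLinearMap A, φ.compLinearMap A] := by
  let b := Module.finBasisOfFinrankEq ℝ W hW
  have hli : LinearIndependent ℝ (A ∘ b) :=
    b.linearIndependent.map' A (LinearMap.ker_eq_bot.2 hA)
  obtain ⟨x, hx⟩ : ∃ x, x ∉ Submodule.span ℝ (Set.range (A ∘ b)) := by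
    by_contra! hall
    have h3 := finrank_span_eq_card hli
    rw [Submodule.eq_top_iff'.2 hall, finrank_top, hV] at h3
    simp at h3
  have hli' : LinearIndependent ℝ (Fin.cons x (A ∘ b) : Fin 4 → V) :=
    linearIndependent_finCons.2 ⟨hli, hx⟩
  set e : Fin 4 → V := Fin.cons x (A ∘ b) with he
  have hc : ε e ≠ 0 := by
    have h := (AlternatingMap.map_basis_ne_zero_iff
      (basisOfLinearIndependentOfCardEqFinrank hli' (by simp [hV])) ε).2 hε
    rwa [coe_basisOfLinearIndependentOfCardEqFinrank] at h
  rw [LinearIndependent.pair_iff]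
  intro s t hst
  have hres : ∀ i j : Fin 3,
      s * ω ![e i.succ, e j.succ] + t * φ ![e i.succ, e j.succ] = 0 := by
    intro i j
    have h := DFunLike.congr_fun hst ![b i, b j]
    have hA2 : A ∘ ![b i, b j] = ![e i.succ, e j.succ] := by
      ext k
      fin_cases k <;> simp [he]
    simpa [Function.comp_def, ← hA2] using h
  have h12 : s * ω ![e 1, e 2] + t * φ ![e 1, e 2] = 0 := hres 0 1
  have h13 : s * ω ![e 1, e 3] + t * φ ![e 1, e 3] = 0 := hres 0 2
  have h23 : s * ω ![e 2, e 3] + t * φ ![e 2, e 3] = 0 := hres 1 2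
  have hwedge : ∀ α β, wedge α β e = B α β * ε e := fun α β => by
    rw [hB α β, AlternatingMap.smul_apply, smul_eq_mul]
  have hP := hwedge ω ω
  have hQ := hwedge ω φ
  have hR := hwedge φ φ
  rw [wedge_apply] at hP hQ hR
  refine eq_zero_of_quadratic_eq_zero hell (mul_right_cancel₀ hc ?_)
  linear_combination (-s ^ 2) * hP - 2 * s * t * hQ - t ^ 2 * hR
    + 2 * (s * ω ![e 0, e 1] + t * φ ![e 0, e 1]) * h23
    - 2 * (s * ω ![e 0, e 2] + t * φ ![e 0, e 2]) * h13
    + 2 * (s * ω ![e 0, e 3] + t * φ ![e 0, e 3]) * h12
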